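/- arXiv:1905.02408 — 2 statements merged into one kernel-verified Lean document; each statement's English description precedes it below -/
import Mathlib

section
/- Let E(t,x;b,y) = (1+t)^{−μ/2+(1−√δ)/2} (1+b)^{μ/2+(1−√δ)/2} ((t+b+2)²−(y−x)²)^{(√δ−1)/2} · ₂F₁((1−√δ)/2, (1−√δ)/2; 1; z(t,x;b,y)) with z as above and δ = (μ−1)²−4ν² ≥ 0, μ, ν² ≥ 0. Then for 0 ≤ b ≤ t and x−t+b ≤ y ≤ x+t−b (with strict inequality so that z ∈ [0,1)), E satisfies ∂²E/∂t² − ∂²E/∂x² + (μ/(1+t))∂E/∂t + (ν²/(1+t)²)E = 0. -/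
noncomputable def hyp (a b c z : ℝ) : ℝ :=
  ∑' n : ℕ, (∏ i ∈ Finset.range n, ((a + (i : ℝ)) * (b + (i : ℝ)) / ((c + (i : ℝ)) * ((i : ℝ) + 1)))) * z ^ n

noncomputable def zfun (t x b y : ℝ) : ℝ :=
  ((t - b)^2 - (y - x)^2) / ((t + b + 2)^2 - (y - x)^2)

noncomputable def Ker (μ ν2 t x b y : ℝ) : ℝ :=
  (1 + t) ^ (-μ/2 + (1 - Real.sqrt ((μ - 1)^2 - 4*ν2))/2) *
  (1 + b) ^ (μ/2 + (1 - Real.sqrt ((μ - 1)^2 - 4*ν2))/2) *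
  (((t + b + 2)^2 - (y - x)^2) ^ ((Real.sqrt ((μ - 1)^2 - 4*ν2) - 1)/2)) *
  hyp ((1 - Real.sqrt ((μ - 1)^2 - 4*ν2))/2) ((1 - Real.sqrt ((μ - 1)^2 - 4*ν2))/2) 1 (zfun t x b y)

open Filter Topology

/-- `∑ c n * z ^ n` converges absolutely for `|z| < 1`. -/
def SummableOnUnitBall (c : ℕ → ℝ) : Prop :=
  ∀ r : ℝ, 0 ≤ r → r < 1 → Summable fun n => |c n| * r ^ n

/-- The coefficients of the termwise derivative of `∑ c n * z ^ n`. -/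
def derivCoeff (c : ℕ → ℝ) (n : ℕ) : ℝ := (n + 1) * c (n + 1)

lemma SummableOnUnitBall.summable {c : ℕ → ℝ} (hc : SummableOnUnitBall c) {z : ℝ} (hz : |z| < 1) :
    Summable fun n => c n * z ^ n := by
  refine Summable.of_norm ?_
  simpa [abs_mul, abs_pow] using hc |z| (abs_nonneg z) hz

lemma SummableOnUnitBall.summable_succ_mul {c : ℕ → ℝ} (hc : SummableOnUnitBall c)
    {r : ℝ} (hr0 : 0 ≤ r) (hr1 : r < 1) :
    Summable fun n : ℕ => |c (n + 1)| * (n + 1) * r ^ n := by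
  obtain ⟨ρ, hrρ, hρ1⟩ := exists_between hr1
  have hρ0 : 0 < ρ := hr0.trans_lt hrρ
  have hs : Summable fun n => |c (n + 1)| * ρ ^ (n + 1) :=
    (summable_nat_add_iff 1).2 (hc ρ hρ0.le hρ1)
  have hq0 : 0 ≤ r / ρ := div_nonneg hr0 hρ0.le
  have hq : ‖r / ρ‖ < 1 := by
    rw [Real.norm_of_nonneg hq0]; exact (div_lt_one hρ0).2 hrρ
  have hg : Summable fun n : ℕ => ((n : ℝ) + 1) * (r / ρ) ^ n := by
    have h1 := summable_pow_mul_geometric_of_norm_lt_one 1 hq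
    have h0 := summable_pow_mul_geometric_of_norm_lt_one 0 hq
    refine (h1.add h0).congr fun n => ?_
    simp; ring
  have hev : ∀ᶠ n : ℕ in atTop, ((n : ℝ) + 1) * (r / ρ) ^ n ≤ ρ :=
    (hg.tendsto_atTop_zero.eventually (gt_mem_nhds hρ0)).mono fun _ h => le_of_lt h
  refine summable_of_isBigO_nat hs (Asymptotics.IsBigO.of_bound 1 ?_)
  filter_upwards [hev] with n hn
  have hr : r ^ n = (r / ρ) ^ n * ρ ^ n := by
    rw [← mul_pow, div_mul_cancel₀ _ hρ0.ne']
  rw [Real.norm_of_nonneg (by positivity), Real.norm_of_nonneg (by positivity), hr, one_mul,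
    pow_succ]
  calc |c (n + 1)| * (n + 1) * ((r / ρ) ^ n * ρ ^ n)
      = |c (n + 1)| * ρ ^ n * ((n + 1) * (r / ρ) ^ n) := by ring
    _ ≤ |c (n + 1)| * ρ ^ n * ρ := by gcongr
    _ = _ := by ring

lemma SummableOnUnitBall.derivCoeff {c : ℕ → ℝ} (hc : SummableOnUnitBall c) :
    SummableOnUnitBall (derivCoeff c) := by
  intro r hr0 hr1
  refine (hc.summable_succ_mul hr0 hr1).congr fun n => ?_
  rw [_root_.derivCoeff, abs_mul, abs_of_nonneg (by positivity : (0 : ℝ) ≤ n + 1)]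
  ring

lemma SummableOnUnitBall.hasDerivAt_tsum {c : ℕ → ℝ} (hc : SummableOnUnitBall c) {z : ℝ}
    (hz : |z| < 1) :
    HasDerivAt (fun z => ∑' n, c n * z ^ n) (∑' n, _root_.derivCoeff c n * z ^ n) z := by
  obtain ⟨r, hzr, hr1⟩ := exists_between hz
  have hr0 : 0 ≤ r := (abs_nonneg z).trans hzr.le
  have hsplit : (∑' n, _root_.derivCoeff c n * z ^ n) = ∑' n : ℕ, c n * (n * z ^ (n - 1)) := by
    have hs : Summable fun n : ℕ => c n * (n * z ^ (n - 1)) := by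
      refine (summable_nat_add_iff 1).1 ((hc.derivCoeff.summable hz).congr fun n => ?_)
      simp [_root_.derivCoeff]; ring
    rw [hs.tsum_eq_zero_add]
    simp only [Nat.cast_zero, zero_mul, mul_zero, zero_add]
    refine tsum_congr fun n => ?_
    simp [_root_.derivCoeff]; ring
  rw [hsplit]
  have hu : Summable fun n : ℕ => |c n| * (n * r ^ (n - 1)) := by
    refine (summable_nat_add_iff 1).1 ((hc.summable_succ_mul hr0 hr1).congr fun n => ?_)
    simp; ring
  refine hasDerivAt_tsum_of_isPreconnected hu (t := Metric.ball 0 r) Metric.isOpen_ball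
    (convex_ball 0 r).isPreconnected (fun n y _ => (hasDerivAt_pow n y).const_mul (c n))
    (fun n y hy => ?_) (y₀ := 0) (y := z) ?_ ?_ ?_
  · rw [mem_ball_zero_iff, Real.norm_eq_abs] at hy
    rw [norm_mul, norm_mul, norm_pow, Real.norm_eq_abs, Real.norm_eq_abs, Real.norm_eq_abs,
      Nat.abs_cast]
    gcongr
  · simpa using (abs_nonneg z).trans_lt hzr
  · exact hc.summable (by simp)
  · simpa using hzr

lemma HasSum.mul_of_succ {d e : ℕ → ℝ} {z s : ℝ} (h : HasSum (fun n => d n * z ^ n) s)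
    (h0 : e 0 = 0) (he : ∀ n, e (n + 1) = d n) : HasSum (fun n => e n * z ^ n) (z * s) := by
  rw [← hasSum_nat_add_iff' 1]
  simpa [h0, he, pow_succ, mul_comm, mul_left_comm] using h.mul_left z

/-- The Taylor coefficients of `₂F₁(a, b; c; ·)`. -/
noncomputable def hypCoeff (a b c : ℝ) (n : ℕ) : ℝ :=
  ∏ i ∈ Finset.range n, ((a + (i : ℝ)) * (b + (i : ℝ)) / ((c + (i : ℝ)) * ((i : ℝ) + 1)))

lemma hypCoeff_succ (a b c : ℝ) (n : ℕ) : hypCoeff a b c (n + 1) =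
    hypCoeff a b c n * ((a + n) * (b + n) / ((c + n) * (n + 1))) :=
  Finset.prod_range_succ _ _

lemma summableOnUnitBall_hypCoeff (a b c : ℝ) : SummableOnUnitBall (hypCoeff a b c) := by
  intro r hr0 hr1
  obtain ⟨ρ, hrρ, hρ1⟩ := exists_between hr1
  have hlim (a c : ℝ) : Tendsto (fun n : ℕ => (a + n) / (c + n)) atTop (𝓝 1) := by
    have := tendsto_add_mul_div_add_mul_atTop_nhds a c (1 : ℝ) (one_ne_zero (α := ℝ))
    simpa using this
  have hratio : Tendsto (fun n : ℕ => |(a + n) / (c + n) * ((b + n) / (1 + n))| * r) atTop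
      (𝓝 r) := by
    simpa using (((hlim a c).mul (hlim b 1)).abs).mul_const r
  refine summable_of_ratio_norm_eventually_le hρ1 ?_
  filter_upwards [hratio.eventually (gt_mem_nhds hrρ)] with n hn
  rw [hypCoeff_succ, abs_mul, norm_mul, norm_mul, norm_mul, norm_pow, norm_pow]
  simp only [Real.norm_eq_abs, abs_abs, abs_of_nonneg hr0]
  rw [mul_div_mul_comm, add_comm (n : ℝ) 1]
  calc _ = |(a + n) / (c + n) * ((b + n) / (1 + n))| * r * (|hypCoeff a b c n| * r ^ n) := by ring
    _ ≤ _ := by gcongr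

/-- The sum of the power series obtained by differentiating `hyp a b c` termwise `k` times. -/
noncomputable def hypDeriv (a b c : ℝ) (k : ℕ) (z : ℝ) : ℝ :=
  ∑' n, derivCoeff^[k] (hypCoeff a b c) n * z ^ n

lemma summableOnUnitBall_iterate (a b c : ℝ) (k : ℕ) :
    SummableOnUnitBall (derivCoeff^[k] (hypCoeff a b c)) := by
  induction k with
  | zero => exact summableOnUnitBall_hypCoeff a b c
  | succ k ih => rw [Function.iterate_succ_apply']; exact ih.derivCoeff

lemma hasDerivAt_hypDeriv (a b c : ℝ) (k : ℕ) {z : ℝ} (hz : |z| < 1) :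
    HasDerivAt (hypDeriv a b c k) (hypDeriv a b c (k + 1) z) z := by
  rw [hypDeriv, Function.iterate_succ_apply']
  exact (summableOnUnitBall_iterate a b c k).hasDerivAt_tsum hz

lemma hypDeriv_zero (a b c : ℝ) : hypDeriv a b c 0 = hyp a b c := rfl

/-- The Gauss hypergeometric differential equation. -/
lemma hypergeometric_equation (a b c : ℝ) (hc : ∀ n : ℕ, c + n ≠ 0) {z : ℝ} (hz : |z| < 1) :
    z * (1 - z) * hypDeriv a b c 2 z + (c - (a + b + 1) * z) * hypDeriv a b c 1 z
      - a * b * hypDeriv a b c 0 z = 0 := by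
  have hsum (k : ℕ) : HasSum (fun n => derivCoeff^[k] (hypCoeff a b c) n * z ^ n)
      (hypDeriv a b c k z) := ((summableOnUnitBall_iterate a b c k).summable hz).hasSum
  have h0 := hsum 0
  have h1 := hsum 1
  have h2 := hsum 2
  simp only [Function.iterate_succ_apply', Function.iterate_zero, id] at h0 h1 h2
  have hz1 := h1.mul_of_succ (e := fun n => n * hypCoeff a b c n) (by simp)
    (fun n => by simp [derivCoeff])
  have hz2 := h2.mul_of_succ (e := fun n => n * ((n + 1) * hypCoeff a b c (n + 1))) (by simp)
    (fun n => by simp [derivCoeff])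
  have hzz2 := hz2.mul_of_succ (e := fun n => (n - 1) * (n * hypCoeff a b c n)) (by simp)
    (fun n => by simp)
  have key := ((hz2.sub hzz2).add ((h1.mul_left c).sub (hz1.mul_left (a + b + 1)))).sub
    (h0.mul_left (a * b))
  have hzero := key.unique (hasSum_zero.congr_fun fun n => ?_)
  · linear_combination hzero
  · have hn := hc n
    have hn' : (n : ℝ) + 1 ≠ 0 := by positivity
    simp only [derivCoeff, hypCoeff_succ]
    field_simp
    ring

lemma HasDerivAt.mul_comp_of_logDeriv {F F1 w L z z1 : ℝ → ℝ} {s : ℝ}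
    (hF : HasDerivAt F (F1 (z s)) (z s)) (hw : HasDerivAt w (L s * w s) s)
    (hz : HasDerivAt z (z1 s) s) :
    HasDerivAt (fun s => w s * F (z s)) (w s * (L s * F (z s) + z1 s * F1 (z s))) s := by
  refine (hw.mul (hF.comp s hz)).congr_deriv ?_
  simp; ring

/-- First and second derivatives of `w * F ∘ z`, where `w` has logarithmic derivative `L`. -/
lemma deriv_deriv_mul_comp {F F1 F2 f w L z z1 : ℝ → ℝ} {s L1 z2 : ℝ}
    (hF : ∀ v, |v| < 1 → HasDerivAt F (F1 v) v) (hF1 : ∀ v, |v| < 1 → HasDerivAt F1 (F2 v) v)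
    (hf : ∀ᶠ u in 𝓝 s, f u = w u * F (z u))
    (hzs : |z s| < 1) (hw : ∀ᶠ u in 𝓝 s, HasDerivAt w (L u * w u) u)
    (hz : ∀ᶠ u in 𝓝 s, HasDerivAt z (z1 u) u)
    (hL : HasDerivAt L L1 s) (hz1 : HasDerivAt z1 z2 s) :
    deriv f s = w s * (L s * F (z s) + z1 s * F1 (z s)) ∧
    deriv (deriv f) s = w s * ((L s ^ 2 + L1) * F (z s) + (2 * L s * z1 s + z2) * F1 (z s)
      + z1 s ^ 2 * F2 (z s)) := by
  have hbd : ∀ᶠ u in 𝓝 s, |z u| < 1 :=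
    hz.self_of_nhds.continuousAt.abs.eventually (gt_mem_nhds hzs)
  have hd : deriv f =ᶠ[𝓝 s] fun u => w u * (L u * F (z u) + z1 u * F1 (z u)) := by
    filter_upwards [hf.eventually_nhds, hw, hz, hbd] with u hfu hwu hzu hbu
    rw [EventuallyEq.deriv_eq hfu]
    exact ((hF _ hbu).mul_comp_of_logDeriv hwu hzu).deriv
  refine ⟨hd.self_of_nhds, ?_⟩
  rw [hd.deriv_eq]
  have hw' := hw.self_of_nhds
  have hz' := hz.self_of_nhds
  refine (hw'.mul ((hL.mul ((hF _ hzs).comp s hz')).add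
    (hz1.mul ((hF1 _ hzs).comp s hz')))).deriv.trans ?_
  simp; ring

lemma zfun_eq {t x b y : ℝ} (hD : (t + b + 2) ^ 2 - (y - x) ^ 2 ≠ 0) :
    zfun t x b y = 1 - 4 * (1 + t) * (1 + b) / ((t + b + 2) ^ 2 - (y - x) ^ 2) := by
  rw [zfun]
  field_simp
  ring

lemma HasDerivAt.rpow_const_logDeriv {g : ℝ → ℝ} {g' s : ℝ} (p : ℝ) (hg : HasDerivAt g g' s)
    (hpos : 0 < g s) : HasDerivAt (fun u => g u ^ p) (p * g' / g s * g s ^ p) s := by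
  refine (hg.rpow_const (p := p) (Or.inl hpos.ne')).congr_deriv ?_
  rw [Real.rpow_sub_one hpos.ne']
  ring

lemma HasDerivAt.mul_logDeriv {g h : ℝ → ℝ} {k l s : ℝ} (hg : HasDerivAt g (k * g s) s)
    (hh : HasDerivAt h (l * h s) s) :
    HasDerivAt (fun u => g u * h u) ((k + l) * (g s * h s)) s :=
  (hg.mul hh).congr_deriv (by ring)

/-- The algebraic prefactor of the kernel `Ker`, with free exponents. -/
noncomputable def kernelWeight (p q a t x b y : ℝ) : ℝ :=
  (1 + t) ^ p * (1 + b) ^ q * ((t + b + 2) ^ 2 - (y - x) ^ 2) ^ (-a)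

section

variable {p q a t x b y : ℝ}

lemma hasDerivAt_time (D : ℝ → ℝ) (hDdef : D = fun u => (u + b + 2) ^ 2 - (y - x) ^ 2) (u : ℝ) :
    HasDerivAt D (2 * (u + b + 2)) u := by
  subst hDdef
  refine (((((hasDerivAt_id u).add_const b).add_const 2).pow 2).sub_const _).congr_deriv ?_
  simp

lemma hasDerivAt_space (D : ℝ → ℝ) (hDdef : D = fun u => (t + b + 2) ^ 2 - (y - u) ^ 2) (u : ℝ) :
    HasDerivAt D (2 * (y - u)) u := by
  subst hDdef
  refine ((((hasDerivAt_id u).const_sub y).pow 2).const_sub _).congr_deriv ?_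
  simp

lemma kernelWeight_time (ht : 0 < 1 + t) (hD : 0 < (t + b + 2) ^ 2 - (y - x) ^ 2) :
    HasDerivAt (fun u => kernelWeight p q a u x b y)
      ((p / (1 + t) - a * (2 * (t + b + 2)) / ((t + b + 2) ^ 2 - (y - x) ^ 2))
        * kernelWeight p q a t x b y) t := by
  have hT : HasDerivAt (fun u : ℝ => 1 + u) 1 t := (hasDerivAt_id t).const_add 1
  have h := ((hT.rpow_const_logDeriv p ht).mul_const ((1 + b) ^ q)).congr_deriv (mul_assoc _ _ _)
  refine (h.mul_logDeriv ((hasDerivAt_time _ rfl t).rpow_const_logDeriv (-a) hD)).congr_deriv ?_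
  simp only [kernelWeight]
  ring

lemma kernelWeight_space (hD : 0 < (t + b + 2) ^ 2 - (y - x) ^ 2) :
    HasDerivAt (fun u => kernelWeight p q a t u b y)
      (-(a * (2 * (y - x)) / ((t + b + 2) ^ 2 - (y - x) ^ 2)) * kernelWeight p q a t x b y) x := by
  refine (((hasDerivAt_space _ rfl x).rpow_const_logDeriv (-a) hD).const_mul
    ((1 + t) ^ p * (1 + b) ^ q)).congr_deriv ?_
  simp only [kernelWeight]
  ring

lemma deriv_time {F F1 F2 : ℝ → ℝ}
    (hF : ∀ v, |v| < 1 → HasDerivAt F (F1 v) v) (hF1 : ∀ v, |v| < 1 → HasDerivAt F1 (F2 v) v)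
    (ht : 0 < 1 + t) {D : ℝ} (hDdef : D = (t + b + 2) ^ 2 - (y - x) ^ 2) (hD : 0 < D)
    (hz : |zfun t x b y| < 1) :
    deriv (fun u => kernelWeight p q a u x b y * F (zfun u x b y)) t =
      kernelWeight p q a t x b y * ((p / (1 + t) - a * (2 * (t + b + 2)) / D) * F (zfun t x b y)
        + (-(4 * (1 + b) / D) + 8 * (1 + t) * (1 + b) * (t + b + 2) / D ^ 2)
          * F1 (zfun t x b y)) ∧
    deriv (deriv fun u => kernelWeight p q a u x b y * F (zfun u x b y)) t =
      kernelWeight p q a t x b y * (((p / (1 + t) - a * (2 * (t + b + 2)) / D) ^ 2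
          + (-(p / (1 + t) ^ 2) - 2 * a / D + 4 * a * (t + b + 2) ^ 2 / D ^ 2))
            * F (zfun t x b y)
        + (2 * (p / (1 + t) - a * (2 * (t + b + 2)) / D)
            * (-(4 * (1 + b) / D) + 8 * (1 + t) * (1 + b) * (t + b + 2) / D ^ 2)
          + (8 * (1 + b) * (2 * (t + b + 2) + (1 + t)) / D ^ 2
            - 32 * (1 + t) * (1 + b) * (t + b + 2) ^ 2 / D ^ 3)) * F1 (zfun t x b y)
        + (-(4 * (1 + b) / D) + 8 * (1 + t) * (1 + b) * (t + b + 2) / D ^ 2) ^ 2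
          * F2 (zfun t x b y)) := by
  subst hDdef
  have hnear : ∀ᶠ u in 𝓝 t, 0 < 1 + u ∧ 0 < (u + b + 2) ^ 2 - (y - x) ^ 2 :=
    ((continuous_const.add continuous_id).continuousAt.eventually (lt_mem_nhds ht)).and
      ((hasDerivAt_time _ rfl t).continuousAt.eventually (lt_mem_nhds hD))
  have hT (u : ℝ) : HasDerivAt (fun u : ℝ => 1 + u) 1 u := (hasDerivAt_id u).const_add 1
  have hS (u : ℝ) : HasDerivAt (fun u : ℝ => 2 * (u + b + 2)) 2 u := by
    simpa using (((hasDerivAt_id u).add_const b).add_const 2).const_mul 2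
  have hDt (u : ℝ) := hasDerivAt_time (x := x) (b := b) (y := y) _ rfl u
  refine deriv_deriv_mul_comp (f := fun u => kernelWeight p q a u x b y * F (zfun u x b y))
    (w := fun u => kernelWeight p q a u x b y) (z := fun u => zfun u x b y)
    (L := fun u => p / (1 + u) - a * (2 * (u + b + 2)) / ((u + b + 2) ^ 2 - (y - x) ^ 2))
    (z1 := fun u => -(4 * (1 + b) / ((u + b + 2) ^ 2 - (y - x) ^ 2))
      + 8 * (1 + u) * (1 + b) * (u + b + 2) / ((u + b + 2) ^ 2 - (y - x) ^ 2) ^ 2)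
    hF hF1 (Eventually.of_forall fun _ => rfl) hz ?_ ?_ ?_ ?_
  · filter_upwards [hnear] with u hu
    exact kernelWeight_time hu.1 hu.2
  · filter_upwards [hnear.eventually_nhds] with u hu
    have hne := hu.self_of_nhds.2.ne'
    refine HasDerivAt.congr_of_eventuallyEq ?_ (hu.mono fun v hv => zfun_eq hv.2.ne')
    refine (((((hT u).const_mul 4).mul_const (1 + b)).div (hDt u) hne).const_sub 1).congr_deriv ?_
    field_simp
    ring
  · refine (((hasDerivAt_const t p).div (hT t) ht.ne').sub
      (((hS t).const_mul a).div (hDt t) hD.ne')).congr_deriv ?_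
    field_simp
    ring
  · have hS' : HasDerivAt (fun u : ℝ => u + b + 2) 1 t :=
      ((hasDerivAt_id t).add_const b).add_const 2
    refine (((hasDerivAt_const t (4 * (1 + b))).div (hDt t) hD.ne').neg.add
      (((((hT t).const_mul 8).mul_const (1 + b)).mul hS').div ((hDt t).pow 2)
        (pow_ne_zero 2 hD.ne'))).congr_deriv ?_
    have hD0 := hD.ne'
    simp only [Pi.mul_apply, Pi.pow_apply, Nat.cast_ofNat, Nat.add_one_sub_one, pow_one]
    generalize (t + b + 2) ^ 2 - (y - x) ^ 2 = D at hD0 ⊢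
    field_simp
    ring

lemma deriv_space {F F1 F2 : ℝ → ℝ}
    (hF : ∀ v, |v| < 1 → HasDerivAt F (F1 v) v) (hF1 : ∀ v, |v| < 1 → HasDerivAt F1 (F2 v) v)
    {D : ℝ} (hDdef : D = (t + b + 2) ^ 2 - (y - x) ^ 2) (hD : 0 < D)
    (hz : |zfun t x b y| < 1) :
    deriv (deriv fun u => kernelWeight p q a t u b y * F (zfun t u b y)) x =
      kernelWeight p q a t x b y * (((-(a * (2 * (y - x)) / D)) ^ 2
          + (2 * a / D + 4 * a * (y - x) ^ 2 / D ^ 2)) * F (zfun t x b y)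
        + (2 * (-(a * (2 * (y - x)) / D)) * (8 * (1 + t) * (1 + b) * (y - x) / D ^ 2)
          + (-(8 * (1 + t) * (1 + b) / D ^ 2)
            - 32 * (1 + t) * (1 + b) * (y - x) ^ 2 / D ^ 3)) * F1 (zfun t x b y)
        + (8 * (1 + t) * (1 + b) * (y - x) / D ^ 2) ^ 2 * F2 (zfun t x b y)) := by
  subst hDdef
  have hnear : ∀ᶠ u in 𝓝 x, 0 < (t + b + 2) ^ 2 - (y - u) ^ 2 :=
    (hasDerivAt_space _ rfl x).continuousAt.eventually (lt_mem_nhds hD)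
  have hr (u : ℝ) : HasDerivAt (fun u : ℝ => y - u) (-1) u := (hasDerivAt_id u).const_sub y
  have hDx (u : ℝ) := hasDerivAt_space (t := t) (b := b) (y := y) _ rfl u
  refine (deriv_deriv_mul_comp (f := fun u => kernelWeight p q a t u b y * F (zfun t u b y))
    (w := fun u => kernelWeight p q a t u b y) (z := fun u => zfun t u b y)
    (L := fun u => -(a * (2 * (y - u)) / ((t + b + 2) ^ 2 - (y - u) ^ 2)))
    (z1 := fun u => 8 * (1 + t) * (1 + b) * (y - u) / ((t + b + 2) ^ 2 - (y - u) ^ 2) ^ 2)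
    hF hF1 (Eventually.of_forall fun _ => rfl) hz ?_ ?_ ?_ ?_).2
  · filter_upwards [hnear] with u hu
    exact kernelWeight_space hu
  · filter_upwards [hnear.eventually_nhds] with u hu
    have hne := hu.self_of_nhds.ne'
    refine HasDerivAt.congr_of_eventuallyEq ?_ (hu.mono fun v hv => zfun_eq hv.ne')
    refine (((hasDerivAt_const u (4 * (1 + t) * (1 + b))).div (hDx u) hne).const_sub
      1).congr_deriv ?_
    field_simp
    ring
  · refine ((((hr x).const_mul 2).const_mul a).div (hDx x) hD.ne').neg.congr_deriv ?_
    field_simp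
    ring
  · refine (((hr x).const_mul (8 * (1 + t) * (1 + b))).div ((hDx x).pow 2)
      (pow_ne_zero 2 hD.ne')).congr_deriv ?_
    have hD0 := hD.ne'
    simp only [Pi.pow_apply, Nat.cast_ofNat, Nat.add_one_sub_one, pow_one]
    generalize (t + b + 2) ^ 2 - (y - x) ^ 2 = D at hD0 ⊢
    field_simp
    ring

end

lemma Ker_eq (μ ν2 t x b y : ℝ) {a : ℝ} (ha : a = (1 - Real.sqrt ((μ - 1)^2 - 4*ν2))/2) :
    Ker μ ν2 t x b y = kernelWeight (-μ/2 + a) (μ/2 + a) a t x b y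
      * hypDeriv a a 1 0 (zfun t x b y) := by
  rw [Ker, kernelWeight, hypDeriv_zero, ha]
  ring_nf

theorem kernel_solves_equation (μ ν2 : ℝ) (hμ : 0 ≤ μ) (hν : 0 ≤ ν2) (hδ : 0 ≤ (μ - 1)^2 - 4*ν2)
    (t x b y : ℝ) (hb : 0 ≤ b) (hbt : b ≤ t) (hy1 : x - t + b < y) (hy2 : y < x + t - b) :
    deriv (deriv (fun t' => Ker μ ν2 t' x b y)) t
      - deriv (deriv (fun x' => Ker μ ν2 t x' b y)) x
      + μ / (1 + t) * deriv (fun t' => Ker μ ν2 t' x b y) t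
      + ν2 / (1 + t)^2 * Ker μ ν2 t x b y = 0 := by
  obtain ⟨a, ha⟩ : ∃ a, a = (1 - Real.sqrt ((μ - 1)^2 - 4*ν2))/2 := ⟨_, rfl⟩
  have hν2 : ν2 = ((μ - 1) ^ 2 - (1 - 2 * a) ^ 2) / 4 := by
    rw [ha]
    linear_combination Real.sq_sqrt hδ / 4
  have ht : 0 < 1 + t := by linarith
  obtain ⟨D, hDdef⟩ : ∃ D, D = (t + b + 2) ^ 2 - (y - x) ^ 2 := ⟨_, rfl⟩
  have hN : 0 < (t - b) ^ 2 - (y - x) ^ 2 := by nlinarith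
  have hND : D - ((t - b) ^ 2 - (y - x) ^ 2) = 4 * (1 + t) * (1 + b) := by rw [hDdef]; ring
  have hTB : 0 < 4 * (1 + t) * (1 + b) := by positivity
  have hD : 0 < D := by linarith
  have hz : |zfun t x b y| < 1 := by
    rw [zfun, ← hDdef, abs_of_pos (div_pos hN hD), div_lt_one hD]
    linarith
  have hF (k : ℕ) (v : ℝ) (hv : |v| < 1) := hasDerivAt_hypDeriv a a 1 k hv
  have htime := deriv_time (p := -μ/2 + a) (q := μ/2 + a) (a := a) (hF 0) (hF 1) ht hDdef hD hz
  have hspace := deriv_space (p := -μ/2 + a) (q := μ/2 + a) (a := a) (hF 0) (hF 1) hDdef hD hz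
  have hode := hypergeometric_equation a a 1 (fun n => by positivity) hz
  simp only [Ker_eq μ ν2 _ _ _ _ ha]
  rw [htime.1, htime.2, hspace]
  have hzD : zfun t x b y = 1 - 4 * (1 + t) * (1 + b) / D := by
    rw [hDdef]; exact zfun_eq (hDdef ▸ hD.ne')
  generalize kernelWeight (-μ/2 + a) (μ/2 + a) a t x b y = w
  generalize hypDeriv a a 1 0 (zfun t x b y) = F0 at *
  generalize hypDeriv a a 1 1 (zfun t x b y) = F1 at *
  generalize hypDeriv a a 1 2 (zfun t x b y) = F2 at *
  rw [hzD] at hode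
  have hr : (y - x) ^ 2 = (t + b + 2) ^ 2 - D := by rw [hDdef]; ring
  generalize y - x = r at *
  clear hz hzD htime hspace hDdef hND
  have hD0 := hD.ne'
  have ht0 := ht.ne'
  rw [hν2]
  have e2 : (-(4 * (1 + b) / D) + 8 * (1 + t) * (1 + b) * (t + b + 2) / D ^ 2) ^ 2
      - (8 * (1 + t) * (1 + b) * r / D ^ 2) ^ 2
      = 4 * (1 + b) / ((1 + t) * D)
        * ((1 - 4 * (1 + t) * (1 + b) / D) * (1 - (1 - 4 * (1 + t) * (1 + b) / D))) := by
    rw [div_pow _ _ 2, mul_pow _ r, hr]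
    field_simp
    ring
  have e1 : 2 * ((-μ / 2 + a) / (1 + t) - a * (2 * (t + b + 2)) / D)
        * (-(4 * (1 + b) / D) + 8 * (1 + t) * (1 + b) * (t + b + 2) / D ^ 2)
      + (8 * (1 + b) * (2 * (t + b + 2) + (1 + t)) / D ^ 2
        - 32 * (1 + t) * (1 + b) * (t + b + 2) ^ 2 / D ^ 3)
      - (2 * (-(a * (2 * r) / D)) * (8 * (1 + t) * (1 + b) * r / D ^ 2)
        + (-(8 * (1 + t) * (1 + b) / D ^ 2) - 32 * (1 + t) * (1 + b) * r ^ 2 / D ^ 3))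
      + μ / (1 + t) * (-(4 * (1 + b) / D) + 8 * (1 + t) * (1 + b) * (t + b + 2) / D ^ 2)
      = 4 * (1 + b) / ((1 + t) * D)
        * (1 - (a + a + 1) * (1 - 4 * (1 + t) * (1 + b) / D)) := by
    rw [show 2 * (-(a * (2 * r) / D)) * (8 * (1 + t) * (1 + b) * r / D ^ 2)
      = -(32 * a * (1 + t) * (1 + b) * r ^ 2 / D ^ 3) by field_simp; ring, hr]
    field_simp
    ring
  have e0 : ((-μ / 2 + a) / (1 + t) - a * (2 * (t + b + 2)) / D) ^ 2
      + (-((-μ / 2 + a) / (1 + t) ^ 2) - 2 * a / D + 4 * a * (t + b + 2) ^ 2 / D ^ 2)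
      - ((-(a * (2 * r) / D)) ^ 2 + (2 * a / D + 4 * a * r ^ 2 / D ^ 2))
      + μ / (1 + t) * ((-μ / 2 + a) / (1 + t) - a * (2 * (t + b + 2)) / D)
      + ((μ - 1) ^ 2 - (1 - 2 * a) ^ 2) / 4 / (1 + t) ^ 2
      = -(4 * (1 + b) / ((1 + t) * D) * (a * a)) := by
    rw [show (-(a * (2 * r) / D)) ^ 2 = 4 * a ^ 2 * r ^ 2 / D ^ 2 by field_simp; ring, hr]
    field_simp
    ring
  linear_combination w * F0 * e0 + w * F1 * e1 + w * F2 * e2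
    + w * (4 * (1 + b) / ((1 + t) * D)) * hode
end

section
/- Under the same hypotheses, the kernel E satisfies the adjoint equation in the variables (b,y): ∂²E/∂b² − ∂²E/∂y² − (μ/(1+b))∂E/∂b + ((μ+ν²)/(1+b)²)E = 0, for 0 ≤ b ≤ t and x−t+b < y < x+t−b. This follows from the symmetry relation E(t,x;b,y) = (1+b)^μ (1+t)^{−μ} E(b,y;t,x). -/
open Filter Topology

/-- A power series whose successive coefficients have ratio tending to `1` converges on the
open unit ball. -/
theorem summable_mul_pow_of_ratio_tendsto_one {c ρ : ℕ → ℝ} (hc : ∀ n, c (n + 1) = ρ n * c n)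
    (hρ : Tendsto ρ atTop (𝓝 1)) {z : ℝ} (hz : |z| < 1) : Summable fun n => c n * z ^ n := by
  obtain ⟨r, hzr, hr⟩ := exists_between hz
  have h : Tendsto (fun n => |ρ n| * |z|) atTop (𝓝 |z|) := by
    simpa using hρ.abs.mul_const |z|
  refine summable_of_ratio_norm_eventually_le hr ?_
  filter_upwards [h.eventually_lt_const hzr] with n hn
  have e : ‖c (n + 1) * z ^ (n + 1)‖ = |ρ n| * |z| * ‖c n * z ^ n‖ := by
    rw [hc, pow_succ]
    simp only [norm_mul, Real.norm_eq_abs]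
    ring
  rw [e]
  gcongr

/-- Termwise differentiation of a power series on the open unit ball. -/
theorem hasDerivAt_tsum_mul_pow {c : ℕ → ℝ} (h0 : ∀ z : ℝ, |z| < 1 → Summable fun n => c n * z ^ n)
    (h1 : ∀ z : ℝ, |z| < 1 → Summable fun n : ℕ => ((n + 1 : ℝ) * c (n + 1)) * z ^ n)
    {z : ℝ} (hz : |z| < 1) :
    HasDerivAt (fun w => ∑' n, c n * w ^ n) (∑' n : ℕ, ((n + 1 : ℝ) * c (n + 1)) * z ^ n) z := by
  obtain ⟨r, hzr, hr⟩ := exists_between hz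
  have hr0 : 0 < r := (abs_nonneg z).trans_lt hzr
  have hu : Summable fun n : ℕ => ‖c n * (n * r ^ (n - 1))‖ := by
    rw [← summable_nat_add_iff 1]
    refine (h1 r (by rwa [abs_of_pos hr0])).norm.congr fun n => ?_
    rw [Nat.add_sub_cancel]
    push_cast
    ring_nf
  have hd := hasDerivAt_tsum_of_isPreconnected (𝕜 := ℝ) (t := Metric.ball (0 : ℝ) r)
    (g := fun n w => c n * w ^ n) (g' := fun n w => c n * (n * w ^ (n - 1))) (y₀ := z) (y := z)
    hu Metric.isOpen_ball (convex_ball (0 : ℝ) r).isPreconnected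
    (fun n y _ => (hasDerivAt_pow n y).const_mul (c n))
    (fun n y hy => by
      have : |y| ≤ r := by simpa using (Metric.mem_ball.1 hy).le
      simp only [norm_mul, norm_pow, Real.norm_eq_abs, abs_of_pos hr0]
      gcongr)
    (by simpa using hzr) (h0 z hz) (by simpa using hzr)
  refine hd.congr_deriv ?_
  have hs : Summable fun n : ℕ => c n * (n * z ^ (n - 1)) := by
    rw [← summable_nat_add_iff 1]
    refine (h1 z hz).congr fun n => ?_
    rw [Nat.add_sub_cancel]
    push_cast
    ring
  rw [hs.tsum_eq_zero_add]
  simp only [Nat.cast_zero, zero_mul, mul_zero, zero_add, Nat.add_sub_cancel]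
  refine tsum_congr fun n => ?_
  push_cast
  ring

theorem HasSum.mul_shift_pow {c : ℕ → ℝ} {z S : ℝ}
    (h : HasSum (fun n : ℕ => ((n + 1 : ℝ) * c (n + 1)) * z ^ n) S) :
    HasSum (fun n : ℕ => (n : ℝ) * c n * z ^ n) (z * S) := by
  rw [← hasSum_nat_add_iff' 1]
  simp only [Finset.range_one, Finset.sum_singleton, Nat.cast_zero, zero_mul, sub_zero]
  refine (h.mul_left z).congr_fun ?_
  intro n
  push_cast
  ring

theorem tendsto_add_natCast_div_add_natCast (a b : ℝ) :
    Tendsto (fun n : ℕ => (a + n) / (b + n)) atTop (𝓝 1) := by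
  simpa using tendsto_add_mul_div_add_mul_atTop_nhds a b (1 : ℝ) one_ne_zero

/-- A power series whose coefficients satisfy the hypergeometric recurrence is twice
differentiable on the open unit ball and solves Gauss's hypergeometric equation there. -/
theorem exists_deriv_gauss_equation {k : ℕ → ℝ} {a b c : ℝ} (hc : ∀ n : ℕ, c + n ≠ 0)
    (hk : ∀ n : ℕ, k (n + 1) = (a + n) / (c + n) * ((b + n) / (1 + n)) * k n) :
    ∃ F₁ F₂ : ℝ → ℝ, ∀ z : ℝ, |z| < 1 →
      HasDerivAt (fun w => ∑' n, k n * w ^ n) (F₁ z) z ∧ HasDerivAt F₁ (F₂ z) z ∧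
      z * (1 - z) * F₂ z + (c - (a + b + 1) * z) * F₁ z - a * b * ∑' n, k n * z ^ n = 0 := by
  have rec_step : ∀ (u : ℕ → ℝ) (σ : ℕ → ℝ), (∀ n, u (n + 1) = σ n * u n) →
      ∀ n : ℕ, ((n + 1 : ℕ) + 1 : ℝ) * u (n + 1 + 1) =
        ((2 + n : ℝ) / (1 + n) * σ (n + 1)) * ((n + 1 : ℝ) * u (n + 1)) := fun u σ h n => by
    have : (1 + n : ℝ) ≠ 0 := by positivity
    rw [h (n + 1)]
    push_cast
    field_simp
    ring
  have lim_step : ∀ σ : ℕ → ℝ, Tendsto σ atTop (𝓝 1) →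
      Tendsto (fun n : ℕ => (2 + n : ℝ) / (1 + n) * σ (n + 1)) atTop (𝓝 1) := fun σ h => by
    simpa using (tendsto_add_natCast_div_add_natCast 2 1).mul (h.comp (tendsto_add_atTop_nat 1))
  have lim₀ : Tendsto (fun n : ℕ => (a + n) / (c + n) * ((b + n) / (1 + n))) atTop (𝓝 1) := by
    simpa using (tendsto_add_natCast_div_add_natCast a c).mul
      (tendsto_add_natCast_div_add_natCast b 1)
  obtain ⟨k₁, hk₁⟩ : ∃ k₁ : ℕ → ℝ, ∀ n : ℕ, k₁ n = (n + 1 : ℝ) * k (n + 1) := ⟨_, fun _ => rfl⟩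
  have rec₁ : ∀ n, k₁ (n + 1) = _ * k₁ n := fun n => by
    rw [hk₁, hk₁]
    exact rec_step k _ hk n
  have lim₁ := lim_step _ lim₀
  have s₀ : ∀ z : ℝ, |z| < 1 → Summable fun n => k n * z ^ n :=
    fun z hz => summable_mul_pow_of_ratio_tendsto_one hk lim₀ hz
  have s₁ : ∀ z : ℝ, |z| < 1 → Summable fun n => k₁ n * z ^ n :=
    fun z hz => summable_mul_pow_of_ratio_tendsto_one rec₁ lim₁ hz
  have s₂ : ∀ z : ℝ, |z| < 1 → Summable fun n : ℕ => ((n + 1 : ℝ) * k₁ (n + 1)) * z ^ n :=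
    fun z hz => summable_mul_pow_of_ratio_tendsto_one (c := fun n => (n + 1 : ℝ) * k₁ (n + 1))
      (rec_step k₁ _ rec₁) (lim_step _ lim₁) hz
  have d₀ : ∀ z : ℝ, |z| < 1 → HasDerivAt (fun w => ∑' n, k n * w ^ n) (∑' n, k₁ n * z ^ n) z := by
    simp only [hk₁] at s₁ ⊢
    exact fun z hz => hasDerivAt_tsum_mul_pow s₀ s₁ hz
  refine ⟨fun z => ∑' n, k₁ n * z ^ n, fun z => ∑' n : ℕ, ((n + 1 : ℝ) * k₁ (n + 1)) * z ^ n,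
    fun z hz => ⟨d₀ z hz, hasDerivAt_tsum_mul_pow s₁ s₂ hz, ?_⟩⟩
  have t₀ := (s₀ z hz).hasSum
  have t₁ := (s₁ z hz).hasSum
  have u₂ := (s₂ z hz).hasSum.mul_shift_pow
  have u₁ := HasSum.mul_shift_pow (c := k) (t₁.congr_fun fun n => by rw [hk₁])
  have v₂ := HasSum.mul_shift_pow (c := fun n : ℕ => ((n : ℝ) - 1) * k n) (z := z) <|
    u₂.congr_fun fun n => by
      rw [hk₁]
      push_cast
      ring
  have key := (((u₂.sub v₂).add (t₁.mul_left c)).sub (u₁.mul_left (a + b + 1))).sub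
    (t₀.mul_left (a * b))
  have sum_zero := key.congr_fun (g := fun _ => 0) fun n => by
    have h : (n + 1 : ℝ) * (c + n) * k (n + 1) = (a + n) * (b + n) * k n := by
      have h1 : (1 + n : ℝ) ≠ 0 := by positivity
      have h2 := hc n
      rw [hk n]
      field_simp
      ring
    rw [hk₁]
    linear_combination -z ^ n * h
  linear_combination sum_zero.unique hasSum_zero

theorem hyp_gauss_equation (a b c : ℝ) (hc : ∀ n : ℕ, c + n ≠ 0) :
    ∃ F₁ F₂ : ℝ → ℝ, ∀ z : ℝ, |z| < 1 →
      HasDerivAt (hyp a b c) (F₁ z) z ∧ HasDerivAt F₁ (F₂ z) z ∧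
      z * (1 - z) * F₂ z + (c - (a + b + 1) * z) * F₁ z - a * b * hyp a b c z = 0 :=
  exists_deriv_gauss_equation hc fun n => by
    rw [Finset.prod_range_succ, div_mul_div_comm, add_comm (1 : ℝ)]
    ring

/-- The first two derivatives of `A * F ∘ z`, where `α` is the logarithmic derivative of `A`. -/
theorem deriv_deriv_mul_comp_s15 {A α z z₁ F F₁ : ℝ → ℝ} {x α' z₂ f₂ : ℝ}
    (hA : ∀ᶠ u in 𝓝 x, HasDerivAt A (A u * α u) u) (hz : ∀ᶠ u in 𝓝 x, HasDerivAt z (z₁ u) u)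
    (hF : ∀ᶠ u in 𝓝 x, HasDerivAt F (F₁ (z u)) (z u)) (hα : HasDerivAt α α' x)
    (hz₁ : HasDerivAt z₁ z₂ x) (hF₁ : HasDerivAt F₁ f₂ (z x)) :
    deriv (fun u => A u * F (z u)) x = A x * (α x * F (z x) + z₁ x * F₁ (z x)) ∧
    deriv (deriv fun u => A u * F (z u)) x =
      A x * ((α x ^ 2 + α') * F (z x) + (2 * α x * z₁ x + z₂) * F₁ (z x) + z₁ x ^ 2 * f₂) := by
  have h : ∀ᶠ u in 𝓝 x, HasDerivAt (fun u => A u * F (z u))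
      (A u * (α u * F (z u) + z₁ u * F₁ (z u))) u := by
    filter_upwards [hA, hz, hF] with u hA hz hF
    exact (hA.mul (hF.comp u hz)).congr_deriv (by simp only [Function.comp_apply]; ring)
  have hF0 := (hF.self_of_nhds).comp x hz.self_of_nhds
  have hF1 := hF₁.comp x hz.self_of_nhds
  have e : deriv (fun u => A u * F (z u)) =ᶠ[𝓝 x]
      fun u => A u * (α u * F (z u) + z₁ u * F₁ (z u)) := h.mono fun u hu => hu.deriv
  refine ⟨h.self_of_nhds.deriv, ?_⟩
  rw [e.deriv_eq]
  refine ((hA.self_of_nhds.mul ((hα.mul hF0).add (hz₁.mul hF1))).congr_deriv ?_).deriv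
  simp only [Function.comp_apply, Pi.add_apply, Pi.mul_apply]
  ring

theorem HasDerivAt.rpow_const_log {f : ℝ → ℝ} {f' x : ℝ} (p : ℝ) (hf : HasDerivAt f f' x)
    (hx : 0 < f x) : HasDerivAt (fun u => f u ^ p) (f x ^ p * (p * f' / f x)) x := by
  refine (hf.rpow_const (p := p) (Or.inl hx.ne')).congr_deriv ?_
  rw [Real.rpow_sub_one hx.ne']
  ring

theorem hasDerivAt_zfun_left {t x b y : ℝ} (hQ : (t + b + 2) ^ 2 - (y - x) ^ 2 ≠ 0) :
    HasDerivAt (fun u => zfun t x u y)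
      (-(4 * (1 + t) * ((1 + t) ^ 2 - (1 + b) ^ 2 - (y - x) ^ 2)) /
        ((t + b + 2) ^ 2 - (y - x) ^ 2) ^ 2) b := by
  have hN : HasDerivAt (fun u => (t - u) ^ 2 - (y - x) ^ 2) (-(2 * (t - b))) b :=
    ((((hasDerivAt_id b).const_sub t).pow 2).sub_const _).congr_deriv (by simp)
  have hD : HasDerivAt (fun u => (t + u + 2) ^ 2 - (y - x) ^ 2) (2 * (t + b + 2)) b :=
    (((((hasDerivAt_id b).const_add t).add_const 2).pow 2).sub_const _).congr_deriv (by simp)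
  exact (hN.div hD hQ).congr_deriv (by field_simp; ring)

theorem hasDerivAt_zfun_right {t x b y : ℝ} (hQ : (t + b + 2) ^ 2 - (y - x) ^ 2 ≠ 0) :
    HasDerivAt (fun v => zfun t x b v)
      (-(8 * (1 + t) * (1 + b) * (y - x)) / ((t + b + 2) ^ 2 - (y - x) ^ 2) ^ 2) y := by
  have hS : HasDerivAt (fun v => (v - x) ^ 2) (2 * (y - x)) y :=
    (((hasDerivAt_id y).sub_const x).pow 2).congr_deriv (by simp)
  exact ((hS.const_sub _).div (hS.const_sub _) hQ).congr_deriv (by field_simp; ring)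

/-- The coefficient identities behind the adjoint equation, with `T = 1 + t`, `B = 1 + b`,
`r = y - x`, `Q = (T + B) ^ 2 - r ^ 2`, and `f`, `f₁`, `f₂` the values of a solution of Gauss's
equation and of its derivatives at `1 - 4 * T * B / Q`. -/
theorem adjoint_equation_algebra {T B r Q a μ f f₁ f₂ : ℝ} (hB : B ≠ 0) (hQ : Q ≠ 0)
    (hQe : Q = (T + B) ^ 2 - r ^ 2)
    (ode : (1 - 4 * T * B / Q) * (4 * T * B / Q) * f₂ +
      (1 - (a + a + 1) * (1 - 4 * T * B / Q)) * f₁ - a * a * f = 0) :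
    (((μ / 2 + a) / B - a * (2 * (T + B)) / Q) ^ 2 +
        (-(μ / 2 + a) / B ^ 2 - 2 * a / Q + 4 * a * (T + B) ^ 2 / Q ^ 2)) * f +
      (2 * ((μ / 2 + a) / B - a * (2 * (T + B)) / Q) *
          (-(4 * T * (T ^ 2 - B ^ 2 - r ^ 2)) / Q ^ 2) +
        (8 * T * B / Q ^ 2 + 16 * T * (T ^ 2 - B ^ 2 - r ^ 2) * (T + B) / Q ^ 3)) * f₁ +
      (-(4 * T * (T ^ 2 - B ^ 2 - r ^ 2)) / Q ^ 2) ^ 2 * f₂ -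
    (((a * (2 * r) / Q) ^ 2 + (2 * a / Q + 4 * a * r ^ 2 / Q ^ 2)) * f +
      (2 * (a * (2 * r) / Q) * (-(8 * T * B * r) / Q ^ 2) +
        (-(8 * T * B) / Q ^ 2 - 32 * T * B * r ^ 2 / Q ^ 3)) * f₁ +
      (-(8 * T * B * r) / Q ^ 2) ^ 2 * f₂) -
    μ / B * (((μ / 2 + a) / B - a * (2 * (T + B)) / Q) * f +
      -(4 * T * (T ^ 2 - B ^ 2 - r ^ 2)) / Q ^ 2 * f₁) +
    (μ + ((μ - 1) ^ 2 - (1 - 2 * a) ^ 2) / 4) / B ^ 2 * f = 0 := by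
  have c₀ : ((μ / 2 + a) / B - a * (2 * (T + B)) / Q) ^ 2 +
        (-(μ / 2 + a) / B ^ 2 - 2 * a / Q + 4 * a * (T + B) ^ 2 / Q ^ 2) -
      ((a * (2 * r) / Q) ^ 2 + (2 * a / Q + 4 * a * r ^ 2 / Q ^ 2)) -
      μ / B * ((μ / 2 + a) / B - a * (2 * (T + B)) / Q) +
      (μ + ((μ - 1) ^ 2 - (1 - 2 * a) ^ 2) / 4) / B ^ 2 = -(4 * T / (B * Q)) * (a * a) := by
    field_simp
    subst hQe
    ring
  have c₁ : 2 * ((μ / 2 + a) / B - a * (2 * (T + B)) / Q) *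
          (-(4 * T * (T ^ 2 - B ^ 2 - r ^ 2)) / Q ^ 2) +
        (8 * T * B / Q ^ 2 + 16 * T * (T ^ 2 - B ^ 2 - r ^ 2) * (T + B) / Q ^ 3) -
      (2 * (a * (2 * r) / Q) * (-(8 * T * B * r) / Q ^ 2) +
        (-(8 * T * B) / Q ^ 2 - 32 * T * B * r ^ 2 / Q ^ 3)) -
      μ / B * (-(4 * T * (T ^ 2 - B ^ 2 - r ^ 2)) / Q ^ 2) =
      4 * T / (B * Q) * (1 - (a + a + 1) * (1 - 4 * T * B / Q)) := by
    field_simp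
    subst hQe
    ring
  have c₂ : (-(4 * T * (T ^ 2 - B ^ 2 - r ^ 2)) / Q ^ 2) ^ 2 - (-(8 * T * B * r) / Q ^ 2) ^ 2 =
      4 * T / (B * Q) * ((1 - 4 * T * B / Q) * (4 * T * B / Q)) := by
    field_simp
    subst hQe
    ring
  linear_combination f * c₀ + f₁ * c₁ + f₂ * c₂ + 4 * T / (B * Q) * ode

theorem kernel_solves_adjoint_equation (μ ν2 : ℝ) (hμ : 0 ≤ μ) (hν : 0 ≤ ν2) (hδ : 0 ≤ (μ - 1)^2 - 4*ν2)
    (t x b y : ℝ) (hb : 0 ≤ b) (hbt : b ≤ t) (hy1 : x - t + b < y) (hy2 : y < x + t - b) :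
    deriv (deriv (fun b' => Ker μ ν2 t x b' y)) b
      - deriv (deriv (fun y' => Ker μ ν2 t x b y')) y
      - μ / (1 + b) * deriv (fun b' => Ker μ ν2 t x b' y) b
      + (μ + ν2) / (1 + b)^2 * Ker μ ν2 t x b y = 0 := by
  unfold Ker
  have hs := Real.sq_sqrt hδ
  set s := Real.sqrt ((μ - 1)^2 - 4*ν2)
  set a := (1 - s) / 2 with ha
  set p := μ / 2 + a with hp
  set q := (s - 1) / 2 with hq
  have hqa : q = -a := by rw [hq, ha]; ring
  obtain ⟨F₁, F₂, hF⟩ := hyp_gauss_equation a a 1 (fun n => by positivity)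
  have hT : 0 < 1 + t := by linarith
  have hB : 0 < 1 + b := by linarith
  have hTB := mul_pos hT hB
  have hN : 0 < (t - b) ^ 2 - (y - x) ^ 2 := by nlinarith
  have hQ : 0 < (t + b + 2) ^ 2 - (y - x) ^ 2 := by nlinarith
  have hz : |zfun t x b y| < 1 := by
    rw [zfun, abs_of_pos (div_pos hN hQ), div_lt_one hQ]
    nlinarith
  have dzb := hasDerivAt_zfun_left hQ.ne'
  have dzy := hasDerivAt_zfun_right hQ.ne'
  obtain ⟨-, hF₁, ode⟩ := hF _ hz
  have hDb : ∀ u : ℝ, HasDerivAt (fun u => (t + u + 2) ^ 2 - (y - x) ^ 2) (2 * (t + u + 2)) u :=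
    fun u => (((((hasDerivAt_id u).const_add t).add_const 2).pow 2).sub_const _).congr_deriv
      (by simp)
  have hDy : ∀ v : ℝ, HasDerivAt (fun v => (t + b + 2) ^ 2 - (v - x) ^ 2) (-(2 * (v - x))) v :=
    fun v => ((((hasDerivAt_id v).sub_const x).pow 2).const_sub _).congr_deriv (by simp)
  have hLb : ∀ u : ℝ, HasDerivAt (fun u => 1 + u) 1 u := fun u => (hasDerivAt_id u).const_add 1
  have evB : ∀ᶠ u in 𝓝 b, 0 < 1 + u := (hLb b).continuousAt.eventually_const_lt hB
  have evQb : ∀ᶠ u in 𝓝 b, 0 < (t + u + 2) ^ 2 - (y - x) ^ 2 :=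
    (hDb b).continuousAt.eventually_const_lt hQ
  have evQy : ∀ᶠ v in 𝓝 y, 0 < (t + b + 2) ^ 2 - (v - x) ^ 2 :=
    (hDy y).continuousAt.eventually_const_lt hQ
  have hS : t + b + 2 = (1 + t) + (1 + b) := by ring
  obtain ⟨eb₁, eb₂⟩ := deriv_deriv_mul_comp_s15 (x := b) (F := hyp a a 1) (F₁ := F₁)
    (A := fun u => (1 + t) ^ (-μ / 2 + a) * (1 + u) ^ p * ((t + u + 2) ^ 2 - (y - x) ^ 2) ^ q)
    (α := fun u => p / (1 + u) - a * (2 * (t + u + 2)) / ((t + u + 2) ^ 2 - (y - x) ^ 2))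
    (z := fun u => zfun t x u y)
    (z₁ := fun u => -(4 * (1 + t) * ((1 + t) ^ 2 - (1 + u) ^ 2 - (y - x) ^ 2)) /
      ((t + u + 2) ^ 2 - (y - x) ^ 2) ^ 2)
    (α' := -p / (1 + b) ^ 2 - 2 * a / ((t + b + 2) ^ 2 - (y - x) ^ 2) +
      4 * a * (t + b + 2) ^ 2 / ((t + b + 2) ^ 2 - (y - x) ^ 2) ^ 2)
    (z₂ := 8 * (1 + t) * (1 + b) / ((t + b + 2) ^ 2 - (y - x) ^ 2) ^ 2 +
      16 * (1 + t) * ((1 + t) ^ 2 - (1 + b) ^ 2 - (y - x) ^ 2) * (t + b + 2) /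
        ((t + b + 2) ^ 2 - (y - x) ^ 2) ^ 3)
    (by
      filter_upwards [evB, evQb] with u h₁ h₂
      exact ((((hLb u).rpow_const_log p h₁).const_mul _).mul
        ((hDb u).rpow_const_log q h₂)).congr_deriv (by rw [hqa]; ring))
    (by
      filter_upwards [evQb] with u h
      exact hasDerivAt_zfun_left h.ne')
    (by
      filter_upwards [dzb.continuousAt.abs.eventually_lt_const hz] with u h
      exact (hF _ h).1)
    ((((hasDerivAt_const b p).div (hLb b) hB.ne').sub
      ((((((hasDerivAt_id b).const_add t).add_const 2).const_mul 2).const_mul a).div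
        (hDb b) hQ.ne')).congr_deriv (by simp only [id]; field_simp; ring))
    (((((((hLb b).pow 2).const_sub ((1 + t) ^ 2)).sub_const ((y - x) ^ 2)).const_mul
      (4 * (1 + t))).neg.div ((hDb b).pow 2) (pow_ne_zero 2 hQ.ne')).congr_deriv (by
        simp only [Pi.pow_apply, Pi.neg_apply]; field_simp; ring))
    hF₁
  obtain ⟨-, ey₂⟩ := deriv_deriv_mul_comp_s15 (x := y) (F := hyp a a 1) (F₁ := F₁)
    (A := fun v => (1 + t) ^ (-μ / 2 + a) * (1 + b) ^ p * ((t + b + 2) ^ 2 - (v - x) ^ 2) ^ q)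
    (α := fun v => a * (2 * (v - x)) / ((t + b + 2) ^ 2 - (v - x) ^ 2))
    (z := fun v => zfun t x b v)
    (z₁ := fun v => -(8 * (1 + t) * (1 + b) * (v - x)) / ((t + b + 2) ^ 2 - (v - x) ^ 2) ^ 2)
    (α' := 2 * a / ((t + b + 2) ^ 2 - (y - x) ^ 2) +
      4 * a * (y - x) ^ 2 / ((t + b + 2) ^ 2 - (y - x) ^ 2) ^ 2)
    (z₂ := -(8 * (1 + t) * (1 + b)) / ((t + b + 2) ^ 2 - (y - x) ^ 2) ^ 2 -
      32 * (1 + t) * (1 + b) * (y - x) ^ 2 / ((t + b + 2) ^ 2 - (y - x) ^ 2) ^ 3)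
    (by
      filter_upwards [evQy] with v h
      exact (((hDy v).rpow_const_log q h).const_mul _).congr_deriv (by rw [hqa]; ring))
    (by
      filter_upwards [evQy] with v h
      exact hasDerivAt_zfun_right h.ne')
    (by
      filter_upwards [dzy.continuousAt.abs.eventually_lt_const hz] with v h
      exact (hF _ h).1)
    ((((((hasDerivAt_id y).sub_const x).const_mul 2).const_mul a).div (hDy y) hQ.ne').congr_deriv
      (by simp only [id]; field_simp; ring))
    (((((hasDerivAt_id y).sub_const x).const_mul (8 * (1 + t) * (1 + b))).neg.div
      ((hDy y).pow 2) (pow_ne_zero 2 hQ.ne')).congr_deriv (by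
        simp only [Pi.pow_apply, Pi.neg_apply, id]; field_simp; ring))
    hF₁
  have hze : zfun t x b y =
      1 - 4 * (1 + t) * (1 + b) / ((t + b + 2) ^ 2 - (y - x) ^ 2) := by
    rw [zfun]
    field_simp
    ring
  have alg := adjoint_equation_algebra (T := 1 + t) (B := 1 + b) (r := y - x) (μ := μ) (a := a)
    (f := hyp a a 1 (zfun t x b y)) (f₁ := F₁ (zfun t x b y)) (f₂ := F₂ (zfun t x b y))
    hB.ne' hQ.ne' (by rw [hS]) (by
      rw [← hze]
      linear_combination ode + zfun t x b y * F₂ (zfun t x b y) * hze)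
  have hν2 : ν2 = ((μ - 1) ^ 2 - (1 - 2 * a) ^ 2) / 4 := by
    rw [ha]
    linear_combination hs / 4
  rw [← hν2, ← hS, ← hp] at alg
  rw [eb₁, eb₂, ey₂]
  linear_combination ((1 + t) ^ (-μ / 2 + a) * (1 + b) ^ p *
    ((t + b + 2) ^ 2 - (y - x) ^ 2) ^ q) * alg
end
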